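/- arXiv:1503.06343 — 7 statements merged into one kernel-verified Lean document; each statement's English description precedes it below -/
import Mathlib

section
/- Let n ≥ 1 and let n₁ and n₂ be two distinct future-oriented unit timelike vectors in Minkowski space ℝ^{1,n}. Then the set F = {v ∈ ℝ^{n+1} : ⟨v,v⟩ = 1, ⟨v,n₁⟩ ≥ 0 and ⟨v,n₂⟩ ≤ 0} (a subset of the de Sitter sphere dSₙ) is bounded for the Euclidean norm of ℝ^{n+1} (hence precompact). -/
/-- The Minkowski bilinear form on ℝ^{1,n} = ℝ^{n+1}:
`⟨x,y⟩ = -x₀y₀ + ∑_{i=1}^n xᵢyᵢ`. -/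
noncomputable def mink {n : ℕ} (x y : EuclideanSpace ℝ (Fin (n + 1))) : ℝ :=
  (∑ i, x i * y i) - 2 * x 0 * y 0

/-- The set `{v ∈ dSₙ : ⟨v,n₁⟩ ≥ 0, ⟨v,n₂⟩ ≤ 0}` determined by two distinct
future-oriented unit timelike vectors is bounded for the Euclidean norm. -/
theorem stmt0 (n : ℕ) (hn : 1 ≤ n) (n₁ n₂ : EuclideanSpace ℝ (Fin (n + 1)))
    (h₁ : mink n₁ n₁ = -1) (h₁pos : 0 < n₁ 0)
    (h₂ : mink n₂ n₂ = -1) (h₂pos : 0 < n₂ 0)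
    (hne : n₁ ≠ n₂) :
    Bornology.IsBounded {v : EuclideanSpace ℝ (Fin (n + 1)) |
      mink v v = 1 ∧ 0 ≤ mink v n₁ ∧ mink v n₂ ≤ 0} := by
  rw [isBounded_iff_forall_norm_le]
  refine ⟨√(1 + 2 * (n₁ 0 ^ 2 + n₂ 0 ^ 2)), ?_⟩
  rintro v ⟨hv, hv1, hv2⟩
  rw [EuclideanSpace.norm_eq]
  apply Real.sqrt_le_sqrt
  have c1 := Finset.sum_mul_sq_le_sq_mul_sq Finset.univ
    (fun i : Fin n => v i.succ) (fun i => n₁ i.succ)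
  have c2 := Finset.sum_mul_sq_le_sq_mul_sq Finset.univ
    (fun i : Fin n => v i.succ) (fun i => n₂ i.succ)
  simp only [mink, Fin.sum_univ_succ, ← pow_two] at h₁ h₂ hv hv1 hv2
  simp only [Real.norm_eq_abs, sq_abs, Fin.sum_univ_succ]
  set U := ∑ i : Fin n, v i.succ ^ 2
  set X := ∑ i : Fin n, n₁ i.succ ^ 2
  set Y := ∑ i : Fin n, n₂ i.succ ^ 2
  set A := ∑ i : Fin n, v i.succ * n₁ i.succ
  set B := ∑ i : Fin n, v i.succ * n₂ i.succ
  have hU : U = 1 + v 0 ^ 2 := by linarith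
  have hX : X = n₁ 0 ^ 2 - 1 := by linarith
  have hY : Y = n₂ 0 ^ 2 - 1 := by linarith
  rw [hU, hX] at c1
  rw [hU, hY] at c2
  rw [hU]
  rcases le_total 0 (v 0) with h | h
  · have k : v 0 * n₁ 0 ≤ A := by linarith
    have k2 := pow_le_pow_left₀ (mul_nonneg h h₁pos.le) k 2
    nlinarith [sq_nonneg (n₂ 0)]
  · have k : -v 0 * n₂ 0 ≤ -B := by linarith
    have k2 := pow_le_pow_left₀ (mul_nonneg (neg_nonneg.2 h) h₂pos.le) k 2
    nlinarith [sq_nonneg (n₁ 0)]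
end

section
/- (Flat comparison lemma.) Let n ≥ 1, let 0 < b < a be real numbers, let r ∈ ℝ^{n+1}, and let N and x be future-oriented unit timelike vectors in Minkowski space ℝ^{1,n}. Set p = r + b·N. Assume that every point of the hyperboloid {r + a·u : u future-oriented unit timelike} lies on the far side of the hyperplane through p orthogonal to x, i.e. ⟨r + a·u, x⟩ ≤ ⟨p, x⟩ for every future-oriented unit timelike u. Then |⟨N, x⟩| ≤ a/b. -/
/-- Flat comparison lemma: if the hyperboloid of Lorentzian radius `a` over `r` lies
on the far side of the hyperplane through `p = r + b·N` orthogonal to `x`,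
then `|⟨N,x⟩| ≤ a/b`. -/
theorem stmt3 (n : ℕ) (hn : 1 ≤ n) (a b : ℝ) (hb : 0 < b) (hba : b < a)
    (r N x : EuclideanSpace ℝ (Fin (n + 1)))
    (hN : mink N N = -1) (hNpos : 0 < N 0)
    (hx : mink x x = -1) (hxpos : 0 < x 0)
    (hyp : ∀ u : EuclideanSpace ℝ (Fin (n + 1)), mink u u = -1 → 0 < u 0 →
      mink (r + a • u) x ≤ mink (r + b • N) x) :
    |mink N x| ≤ a / b := by
  have h1 := hyp x hx hxpos
  have hneg : mink N x ≤ 0 := by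
    simp only [mink, Fin.sum_univ_succ] at hN hx ⊢
    have cs := Finset.sum_mul_sq_le_sq_mul_sq Finset.univ (fun i : Fin n => N i.succ)
      (fun i : Fin n => x i.succ)
    have eN : ∑ i : Fin n, N i.succ ^ 2 = N 0 ^ 2 - 1 := by
      simp only [pow_two]; linarith
    have ex : ∑ i : Fin n, x i.succ ^ 2 = x 0 ^ 2 - 1 := by
      simp only [pow_two]; linarith
    have pN : 0 ≤ ∑ i : Fin n, N i.succ ^ 2 := Finset.sum_nonneg fun i _ => sq_nonneg _
    have px : 0 ≤ ∑ i : Fin n, x i.succ ^ 2 := Finset.sum_nonneg fun i _ => sq_nonneg _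
    rw [eN] at cs pN
    rw [ex] at cs px
    have h := abs_le_of_sq_le_sq (b := N 0 * x 0) (by nlinarith) (by positivity)
      (a := ∑ i : Fin n, N i.succ * x i.succ)
    linarith [(abs_le.mp h).2]
  have lin : ∀ (c : ℝ) (v : EuclideanSpace ℝ (Fin (n + 1))),
      mink (r + c • v) x = mink r x + c * mink v x := by
    intro c v
    simp only [mink, PiLp.add_apply, PiLp.smul_apply, smul_eq_mul, add_mul,
      Finset.sum_add_distrib, mul_sub, Finset.mul_sum, mul_assoc]
    ring
  rw [lin, lin, hx] at h1
  rw [abs_of_nonpos hneg, le_div_iff₀ hb]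
  linarith
end

section
/- (De Sitter comparison lemma.) Let n ≥ 2, let 0 < b < a be real numbers, and work in Minkowski space ℝ^{1,n}. Let r ∈ ℝ^{n+1} with ⟨r,r⟩ = 1, let N be a future-oriented unit timelike vector with ⟨N,r⟩ = 0, and set p = cosh(b)·r + sinh(b)·N and N_p = sinh(b)·r + cosh(b)·N (the future unit normal at p). Let x be a future-oriented unit timelike vector with ⟨x,p⟩ = 0 and ⟨x,N_p⟩ ≤ 0. Assume that for every future-oriented unit timelike vector v with ⟨v,r⟩ = 0 one has ⟨x, cosh(a)·r + sinh(a)·v⟩ ≤ 0. Then |⟨x, N_p⟩| ≤ sinh(a)/sinh(b). -/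
theorem mink_comm' {n : ℕ} (x y : EuclideanSpace ℝ (Fin (n + 1))) : mink x y = mink y x := by
  unfold mink
  rw [Finset.sum_congr rfl (fun i _ => mul_comm (x i) (y i))]
  ring

theorem mink_add_right' {n : ℕ} (x y z : EuclideanSpace ℝ (Fin (n + 1))) :
    mink x (y + z) = mink x y + mink x z := by
  simp only [mink, PiLp.add_apply, mul_add, Finset.sum_add_distrib]
  ring

theorem mink_smul_right' {n : ℕ} (c : ℝ) (x y : EuclideanSpace ℝ (Fin (n + 1))) :
    mink x (c • y) = c * mink x y := by
  simp only [mink, PiLp.smul_apply, smul_eq_mul, mul_sub, Finset.mul_sum]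
  congr 1
  · exact Finset.sum_congr rfl (fun i _ => by ring)
  · ring

theorem mink_future {n : ℕ} (x w : EuclideanSpace ℝ (Fin (n + 1)))
    (hx : mink x x < 0) (hx0 : 0 < x 0) (hw : mink w w < 0) (hxw : mink x w < 0) : 0 < w 0 := by
  by_contra hcon
  push Not at hcon
  have cs := Finset.sum_mul_sq_le_sq_mul_sq Finset.univ
    (fun i : Fin n => x i.succ) (fun i : Fin n => w i.succ)
  simp only [mink, Fin.sum_univ_succ, ← pow_two] at hx hw hxw
  have hB : 0 ≤ ∑ i : Fin n, w i.succ ^ 2 := Finset.sum_nonneg (fun i _ => sq_nonneg _)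
  have h1 : ∑ i : Fin n, x i.succ ^ 2 < x 0 ^ 2 := by linarith
  have h2 : ∑ i : Fin n, w i.succ ^ 2 < w 0 ^ 2 := by linarith
  have h3 : ∑ i : Fin n, x i.succ * w i.succ < x 0 * w 0 := by linarith
  have h4 : x 0 * w 0 ≤ 0 := mul_nonpos_of_nonneg_of_nonpos hx0.le hcon
  have h5 := mul_le_mul h1.le h2.le hB (sq_nonneg (x 0))
  have h6 : (x 0 * w 0) ^ 2 < (∑ i : Fin n, x i.succ * w i.succ) ^ 2 := by nlinarith
  nlinarith

/-- De Sitter comparison lemma. -/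
theorem stmt4 (n : ℕ) (hn : 2 ≤ n) (a b : ℝ) (hb : 0 < b) (hba : b < a)
    (r N x : EuclideanSpace ℝ (Fin (n + 1)))
    (hr : mink r r = 1)
    (hN : mink N N = -1) (hNpos : 0 < N 0) (hNr : mink N r = 0)
    (hx : mink x x = -1) (hxpos : 0 < x 0)
    (hxp : mink x (Real.cosh b • r + Real.sinh b • N) = 0)
    (hxNp : mink x (Real.sinh b • r + Real.cosh b • N) ≤ 0)
    (hyp : ∀ v : EuclideanSpace ℝ (Fin (n + 1)),
      mink v v = -1 → 0 < v 0 → mink v r = 0 →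
      mink x (Real.cosh a • r + Real.sinh a • v) ≤ 0) :
    |mink x (Real.sinh b • r + Real.cosh b • N)| ≤ Real.sinh a / Real.sinh b := by
  have hsb : 0 < Real.sinh b := Real.sinh_pos_iff.2 hb
  have hsa : 0 < Real.sinh a := Real.sinh_pos_iff.2 (hb.trans hba)
  have hca := Real.cosh_pos a
  have eb := Real.cosh_sq b
  have ea := Real.cosh_sq a
  rw [mink_add_right', mink_smul_right', mink_smul_right'] at hxp hxNp ⊢
  set α := mink x r with hα
  have key : (Real.sinh b * α + Real.cosh b * mink x N) * Real.sinh b = -α := by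
    linear_combination Real.cosh b * hxp - α * eb
  have hα0 : 0 ≤ α := by nlinarith
  rw [abs_of_nonpos hxNp, le_div_iff₀ hsb]
  have goal : α ≤ Real.sinh a := by
    set w := x + (-α) • r with hw
    have hxw : mink x w = -(1 + α ^ 2) := by
      rw [hw, mink_add_right', mink_smul_right', hx, ← hα]; ring
    have hrw : mink r w = 0 := by
      rw [hw, mink_add_right', mink_smul_right', hr, mink_comm' r x, ← hα]; ring
    have hww : mink w w = -(1 + α ^ 2) := by
      conv_lhs => rw [hw]
      rw [← hw, mink_comm', mink_add_right', mink_smul_right', mink_comm' w x,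
        mink_comm' w r, hxw, hrw]; ring
    have hpos : 0 < 1 + α ^ 2 := by positivity
    have hw0 := mink_future x w (by linarith) hxpos (by linarith) (by linarith)
    set s := Real.sqrt (1 + α ^ 2) with hs
    have hs0 : 0 < s := Real.sqrt_pos.2 hpos
    have hs2 : s ^ 2 = 1 + α ^ 2 := Real.sq_sqrt hpos.le
    have h := hyp (s⁻¹ • w)
      (by rw [mink_smul_right', mink_comm', mink_smul_right', hww, ← hs2]; field_simp)
      (by simp only [PiLp.smul_apply, smul_eq_mul]; positivity)
      (by rw [mink_comm', mink_smul_right', hrw, mul_zero])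
    rw [mink_add_right', mink_smul_right', mink_smul_right', mink_smul_right', hxw, ← hs2,
      ← hα] at h
    have e : s⁻¹ * -(s ^ 2) = -s := by field_simp
    rw [e] at h
    have h' : Real.cosh a * α ≤ Real.sinh a * s := by linarith
    have h2 := pow_le_pow_left₀ (by positivity) h' 2
    rw [mul_pow, mul_pow, hs2, ea] at h2
    exact (sq_le_sq₀ hα0 hsa.le).1 (by linarith)
  linarith
end

section
/- (Anti-de Sitter comparison lemma.) Let n ≥ 2 and let 0 < b < a < π/2 be real numbers. Work in ℝ^{2,n}. Let r, N, x ∈ ℝ^{n+2} with ⟨r,r⟩ = −1, ⟨N,N⟩ = −1, ⟨N,r⟩ = 0 and ⟨x,x⟩ = −1. Set p = cos(b)·r + sin(b)·N and N_p = −sin(b)·r + cos(b)·N (the future unit normal at p, with N taken as the future direction at r). Assume ⟨x,p⟩ = 0 and ⟨x,N_p⟩ ≤ 0, and assume that for every v ∈ ℝ^{n+2} with ⟨v,v⟩ = −1, ⟨v,r⟩ = 0 and ⟨v,N⟩ < 0 (i.e. v future-oriented at r) one has ⟨x, cos(a)·r + sin(a)·v⟩ ≤ 0. Then |⟨N_p,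 x⟩| ≤ tan(a)/tan(b). -/
/-- The bilinear form of signature (2,n) on ℝ^{2,n} = ℝ^{n+2}:
`⟨x,y⟩ = -x₀y₀ - x₁y₁ + ∑_{i=2}^{n+1} xᵢyᵢ`. -/
noncomputable def mink2 {n : ℕ} (x y : EuclideanSpace ℝ (Fin (n + 2))) : ℝ :=
  (∑ i, x i * y i) - 2 * x 0 * y 0 - 2 * x 1 * y 1

theorem mink2_comm' {n : ℕ} (x y : EuclideanSpace ℝ (Fin (n + 2))) : mink2 x y = mink2 y x := by
  unfold mink2
  rw [Finset.sum_congr rfl (fun i _ => mul_comm (x i) (y i))]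
  ring

theorem mink2_add' {n : ℕ} (x y z : EuclideanSpace ℝ (Fin (n + 2))) :
    mink2 x (y + z) = mink2 x y + mink2 x z := by
  simp only [mink2, PiLp.add_apply, mul_add, Finset.sum_add_distrib]
  ring

theorem mink2_smul' {n : ℕ} (c : ℝ) (x y : EuclideanSpace ℝ (Fin (n + 2))) :
    mink2 x (c • y) = c * mink2 x y := by
  simp only [mink2, PiLp.smul_apply, smul_eq_mul, mul_left_comm _ c, ← Finset.mul_sum]
  ring

theorem mink2_add_left' {n : ℕ} (x y z : EuclideanSpace ℝ (Fin (n + 2))) :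
    mink2 (y + z) x = mink2 y x + mink2 z x := by
  rw [mink2_comm', mink2_add', mink2_comm' x y, mink2_comm' x z]

theorem mink2_smul_left' {n : ℕ} (c : ℝ) (x y : EuclideanSpace ℝ (Fin (n + 2))) :
    mink2 (c • y) x = c * mink2 y x := by
  rw [mink2_comm', mink2_smul', mink2_comm' x y]

/-- Anti-de Sitter comparison lemma. -/
theorem stmt5 (n : ℕ) (hn : 2 ≤ n) (a b : ℝ) (hb : 0 < b) (hba : b < a)
    (ha : a < Real.pi / 2)
    (r N x : EuclideanSpace ℝ (Fin (n + 2)))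
    (hr : mink2 r r = -1)
    (hN : mink2 N N = -1) (hNr : mink2 N r = 0)
    (hx : mink2 x x = -1)
    (hxp : mink2 x (Real.cos b • r + Real.sin b • N) = 0)
    (hxNp : mink2 x (-Real.sin b • r + Real.cos b • N) ≤ 0)
    (hyp : ∀ v : EuclideanSpace ℝ (Fin (n + 2)),
      mink2 v v = -1 → mink2 v r = 0 → mink2 v N < 0 →
      mink2 x (Real.cos a • r + Real.sin a • v) ≤ 0) :
    |mink2 (-Real.sin b • r + Real.cos b • N) x| ≤ Real.tan a / Real.tan b := by
  have hsb : 0 < Real.sin b := Real.sin_pos_of_pos_of_lt_pi hb (by linarith)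
  have hsa : 0 < Real.sin a := Real.sin_pos_of_pos_of_lt_pi (by linarith) (by linarith)
  have hcb : 0 < Real.cos b := Real.cos_pos_of_mem_Ioo ⟨by linarith, by linarith⟩
  have hca : 0 < Real.cos a := Real.cos_pos_of_mem_Ioo ⟨by linarith, by linarith⟩
  have hsub : 0 < Real.sin (a - b) := Real.sin_pos_of_pos_of_lt_pi (by linarith) (by linarith)
  rw [Real.sin_sub] at hsub
  have hsq := Real.sin_sq_add_cos_sq b
  have hc1 := Real.cos_le_one b
  rw [mink2_comm', abs_of_nonpos hxNp, Real.tan_eq_sin_div_cos, Real.tan_eq_sin_div_cos,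
    div_div_div_eq]
  rw [mink2_add', mink2_smul', mink2_smul'] at hxp
  obtain ⟨t, ht⟩ : ∃ t, t = -mink2 x (-Real.sin b • r + Real.cos b • N) := ⟨_, rfl⟩
  rw [← ht]
  have ht' := ht
  rw [mink2_add', mink2_smul', mink2_smul'] at ht'
  have hNr' : mink2 r N = 0 := by rw [mink2_comm', hNr]
  have hR : mink2 x r = t * Real.sin b := by
    linear_combination Real.cos b * hxp - Real.sin b * ht' - mink2 x r * hsq
  have hM : mink2 x N = -(t * Real.cos b) := by
    linear_combination Real.sin b * hxp + Real.cos b * ht' - mink2 x N * hsq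
  have hR' : mink2 r x = t * Real.sin b := by rw [mink2_comm', hR]
  have hM' : mink2 N x = -(t * Real.cos b) := by rw [mink2_comm', hM]
  rw [le_div_iff₀ (by positivity)]
  by_contra! hlt
  have ht1 : 1 < t := by
    by_contra! h
    nlinarith [mul_le_mul_of_nonneg_right h (mul_pos hca hsb).le]
  have key := hyp (x + (t * Real.sin b) • r + (t * (1 - Real.cos b)) • N)
    (by
      simp only [mink2_add', mink2_smul', mink2_add_left', mink2_smul_left', hR, hM, hR', hM',
        hr, hN, hx, hNr, hNr']
      linear_combination t ^ 2 * hsq)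
    (by
      simp only [mink2_add_left', mink2_smul_left', hR, hr, hNr]
      ring)
    (by
      simp only [mink2_add_left', mink2_smul_left', hM, hN, hNr']
      nlinarith)
  simp only [mink2_add', mink2_smul', hR, hM, hx] at key
  have e : Real.sin a * (-1 + t * Real.sin b * (t * Real.sin b)
      + t * (1 - Real.cos b) * -(t * Real.cos b))
      = Real.sin a * (t ^ 2 * (1 - Real.cos b) - 1) := by
    linear_combination Real.sin a * t ^ 2 * hsq
  rw [e] at key
  have : 0 ≤ Real.sin a * ((t ^ 2 - 1) * (1 - Real.cos b)) :=
    mul_nonneg hsa.le (mul_nonneg (by nlinarith) (by linarith))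
  nlinarith
end

section
/- Let H₀ and H₁ be real numbers with H₀ < 3/2. Then the function b ↦ artanh( (H₀ + √(H₁² + (b²−1)(b²+2))) / (b²+2) ) / artanh( b/√(b²+1) ) tends to 1 as b → +∞. -/
open Filter

/-- The inverse hyperbolic tangent, `artanh x = (1/2)·log((1+x)/(1−x))`. -/
noncomputable def artanh (x : ℝ) : ℝ := (1 / 2) * Real.log ((1 + x) / (1 - x))

theorem artanh_asymp (F : ℝ → ℝ) (c : ℝ) (hc : 0 < c) (h0 : F 0 = 1)
    (hF : HasDerivAt F (-c) 0) :
    Tendsto (fun b : ℝ => artanh (F ((b ^ 2)⁻¹)) / Real.log b) atTop (nhds 1) := by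
  have hu : Tendsto (fun b : ℝ => (b ^ 2)⁻¹) atTop (nhdsWithin 0 {0}ᶜ) := by
    have h1 : Tendsto (fun b : ℝ => (b ^ 2)⁻¹) atTop (nhdsWithin 0 (Set.Ioi 0)) :=
      tendsto_inv_atTop_nhdsGT_zero.comp (tendsto_pow_atTop two_ne_zero)
    exact h1.mono_right (nhdsWithin_mono _ (fun x hx => ne_of_gt hx))
  have hs := (hasDerivAt_iff_tendsto_slope_zero.1 hF).comp hu
  have hx : Tendsto (fun b : ℝ => F ((b ^ 2)⁻¹)) atTop (nhds 1) := by
    have := hF.continuousAt.tendsto.comp (hu.mono_right nhdsWithin_le_nhds)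
    rwa [h0] at this
  have hd : Tendsto (fun b : ℝ => b ^ 2 * (1 - F ((b ^ 2)⁻¹))) atTop (nhds c) := by
    have := hs.neg
    rw [neg_neg] at this
    refine this.congr (fun b => ?_)
    simp [h0]
    ring
  have hg : Tendsto (fun b : ℝ => (1 + F ((b ^ 2)⁻¹)) / (b ^ 2 * (1 - F ((b ^ 2)⁻¹)))) atTop
      (nhds ((1 + 1) / c)) := (hx.const_add 1).div hd hc.ne'
  have hl := hg.log (by positivity)
  have hq := (hl.div_atTop Real.tendsto_log_atTop).const_mul (1 / 2 : ℝ) |>.const_add 1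
  simp only [mul_zero, add_zero] at hq
  refine hq.congr' ?_
  filter_upwards [eventually_gt_atTop 1, hd.eventually (lt_mem_nhds hc),
    hx.eventually (lt_mem_nhds (zero_lt_one))] with b hb h1 h2
  have hb2 : 0 < b ^ 2 := by positivity
  have h3 : 0 < 1 - F ((b ^ 2)⁻¹) := pos_of_mul_pos_right h1 hb2.le
  have hlog := Real.log_pos hb
  unfold artanh
  rw [Real.log_div (by positivity) h1.ne', Real.log_mul hb2.ne' h3.ne',
    Real.log_div (by positivity) h3.ne', Real.log_pow]
  field_simp
  push_cast
  ring

/-- The ratio `artanh((H₀ + √(H₁² + (b²−1)(b²+2)))/(b²+2)) / artanh(b/√(b²+1))`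
tends to `1` as `b → +∞`, provided `H₀ < 3/2`. -/
theorem stmt8 (H₀ H₁ : ℝ) (hH₀ : H₀ < 3 / 2) :
    Tendsto (fun b : ℝ =>
      artanh ((H₀ + Real.sqrt (H₁ ^ 2 + (b ^ 2 - 1) * (b ^ 2 + 2))) / (b ^ 2 + 2)) /
        artanh (b / Real.sqrt (b ^ 2 + 1)))
      atTop (nhds 1) := by
  have A := artanh_asymp
    (fun u => (H₀ * u + Real.sqrt (1 + u + (H₁ ^ 2 - 2) * u ^ 2)) / (1 + 2 * u))
    (3 / 2 - H₀) (by linarith) (by simp) (by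
      have hi := hasDerivAt_id (0 : ℝ)
      have h1 : HasDerivAt (fun u : ℝ => 1 + u + (H₁ ^ 2 - 2) * u ^ 2) 1 0 := by
        have := (hi.const_add 1).add ((hi.pow 2).const_mul (H₁ ^ 2 - 2))
        refine HasDerivAt.congr_deriv this ?_
        simp
      have h2 := h1.sqrt (by simp)
      have h3 := ((hi.const_mul H₀).add h2).div ((hi.const_mul 2).const_add 1) (by simp)
      refine HasDerivAt.congr_deriv h3 ?_
      simp
      ring)
  have B := artanh_asymp (fun u => 1 / Real.sqrt (1 + u)) (1 / 2) (by norm_num) (by simp) (by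
      have hi := hasDerivAt_id (0 : ℝ)
      have h2 := (hi.const_add 1).sqrt (by simp)
      have h3 := (hasDerivAt_const (0 : ℝ) (1 : ℝ)).div h2 (by simp)
      refine HasDerivAt.congr_deriv h3 ?_
      simp)
  have C := A.div B one_ne_zero
  rw [div_one] at C
  refine C.congr' ?_
  filter_upwards [eventually_gt_atTop 1] with b hb
  have hb2 : 0 < b ^ 2 := by positivity
  have hlog := Real.log_pos hb
  simp only [Pi.div_apply]
  rw [div_div_div_cancel_right₀ hlog.ne']
  congr 2
  · have : 1 + (b ^ 2)⁻¹ + (H₁ ^ 2 - 2) * (b ^ 2)⁻¹ ^ 2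
        = (H₁ ^ 2 + (b ^ 2 - 1) * (b ^ 2 + 2)) / (b ^ 2) ^ 2 := by
      field_simp
      ring
    rw [this, Real.sqrt_div' _ (by positivity), Real.sqrt_sq hb2.le]
    field_simp
  · have : 1 + (b ^ 2)⁻¹ = (b ^ 2 + 1) / b ^ 2 := by field_simp
    rw [this, Real.sqrt_div' _ (by positivity), Real.sqrt_sq (by positivity), one_div_div]
end

section
/- Let H₀ and H₁ be real numbers with H₀ < 3/2. Then there exist a constant C > 0 and b₀ > 0 such that for every b ≥ b₀, | artanh( b/√(b²+1) ) − artanh( (H₀ + √(H₁² + (b²−1)(b²+2))) / (b²+2) ) | ≤ C. In particular the difference between the two quantities stays bounded as b → +∞, even though each of them tends to +∞. -/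
lemma artanh_aux (x N m M : ℝ) (hx : 0 ≤ x) (hN : 0 < N) (hm : 0 < m)
    (h1 : m ≤ N * (1 - x)) (h2 : N * (1 - x) ≤ M) :
    |artanh x - (1 / 2) * Real.log N| ≤ |Real.log M| + |Real.log (2 / m)| := by
  have hM : 0 < M := by linarith
  have hx1 : 0 < 1 - x := by
    by_contra h
    push Not at h
    nlinarith
  have e1 : N / M ≤ (1 + x) / (1 - x) := by
    rw [div_le_div_iff₀ hM hx1]
    nlinarith
  have e2 : (1 + x) / (1 - x) ≤ N * (2 / m) := by
    rw [← mul_div_assoc, div_le_div_iff₀ hx1 hm]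
    nlinarith
  have l1 := Real.log_le_log (by positivity) e1
  have l2 := Real.log_le_log (by positivity) e2
  rw [Real.log_div hN.ne' hM.ne'] at l1
  rw [Real.log_mul hN.ne' (by positivity)] at l2
  have a1 := le_abs_self (Real.log M)
  have a2 := le_abs_self (Real.log (2 / m))
  have a3 := abs_nonneg (Real.log M)
  have a4 := abs_nonneg (Real.log (2 / m))
  unfold artanh
  rw [abs_le]
  constructor <;> linarith

/-- The difference `artanh(b/√(b²+1)) − artanh((H₀ + √(H₁² + (b²−1)(b²+2)))/(b²+2))`
stays bounded as `b → +∞`, provided `H₀ < 3/2`. -/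
theorem stmt9 (H₀ H₁ : ℝ) (hH₀ : H₀ < 3 / 2) :
    ∃ C > (0 : ℝ), ∃ b₀ > (0 : ℝ), ∀ b ≥ b₀,
      |artanh (b / Real.sqrt (b ^ 2 + 1)) -
        artanh ((H₀ + Real.sqrt (H₁ ^ 2 + (b ^ 2 - 1) * (b ^ 2 + 2))) / (b ^ 2 + 2))| ≤ C := by
  obtain ⟨d, hd⟩ : ∃ d, d = (3 / 2 - H₀) / 2 := ⟨_, rfl⟩
  have hd0 : 0 < d := by linarith
  refine ⟨(|Real.log 2| + |Real.log (2 / (1 / 2))|) +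
    (|Real.log (3 - H₀)| + |Real.log (2 / d)|) + 1, by positivity,
    2 + |H₀| + H₁ ^ 2 / d, by positivity, ?_⟩
  intro b hb
  have q0 : 0 ≤ H₁ ^ 2 / d := by positivity
  have q1 := neg_abs_le H₀
  have q2 := abs_nonneg H₀
  have hb2 : 2 ≤ b := by linarith
  have hbb : 2 * b ≤ b ^ 2 := by nlinarith
  have hq : H₁ ^ 2 ≤ b * d := by
    rw [← div_le_iff₀ hd0]; linarith
  have A := artanh_aux (b / Real.sqrt (b ^ 2 + 1)) (b ^ 2 + 2) (1 / 2) 2 (by positivity)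
    (by positivity) (by norm_num)
  obtain ⟨s, hs⟩ : ∃ s, s = Real.sqrt (b ^ 2 + 1) := ⟨_, rfl⟩
  have hs2 : s ^ 2 = b ^ 2 + 1 := by rw [hs]; exact Real.sq_sqrt (by positivity)
  have hs0 : 0 ≤ s := by rw [hs]; positivity
  rw [← hs] at A ⊢
  have hsb : b < s := by nlinarith
  have hsp : 0 < s := by linarith
  have e : 1 - b / s = 1 / (s * (s + b)) := by
    field_simp
    nlinarith
  have hp : 0 < s * (s + b) := by positivity
  have A' := A (by rw [e, mul_one_div, le_div_iff₀ hp]; nlinarith)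
    (by rw [e, mul_one_div, div_le_iff₀ hp]; nlinarith)
  obtain ⟨N, hN⟩ : ∃ N, N = b ^ 2 + 2 := ⟨_, rfl⟩
  have hN' : b ^ 2 - 1 = N - 3 := by linarith
  rw [← hN] at A' ⊢
  rw [hN']
  have hN3 : 3 ≤ N := by linarith
  have hNp : 0 < N := by linarith
  obtain ⟨S, hS⟩ : ∃ S, S = Real.sqrt (H₁ ^ 2 + (N - 3) * N) := ⟨_, rfl⟩
  rw [← hS]
  have S1 : N - 3 ≤ S := by
    rw [hS]; apply Real.le_sqrt_of_sq_le; nlinarith [sq_nonneg H₁]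
  have S2 : S ≤ N - H₀ - d := by
    rw [hS]
    apply Real.sqrt_le_iff.2
    have : N - H₀ - d = N - 3 / 2 + d := by linarith
    rw [this]
    have : b * d ≤ N * d := by apply mul_le_mul_of_nonneg_right _ hd0.le; linarith
    constructor
    · linarith
    · nlinarith [sq_nonneg (3 / 2 - d), mul_pos hNp hd0]
  have e' : N * (1 - (H₀ + S) / N) = N - H₀ - S := by field_simp; ring
  have B := artanh_aux ((H₀ + S) / N) N d (3 - H₀) (div_nonneg (by linarith) hNp.le) hNp hd0
    (by rw [e']; linarith) (by rw [e']; linarith)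
  rw [abs_le] at A' B ⊢
  constructor <;> linarith [A'.1, A'.2, B.1, B.2]
end

section
/- Let X be a set and let (d_k) be a sequence of pseudometrics on X converging pointwise to a function d : X × X → ℝ. If each d_k satisfies the CAT(0) four-point condition, then d satisfies the CAT(0) four-point condition. -/
open Filter

/-- `d` is a pseudometric on `X`. -/
def IsPseudometric {X : Type*} (d : X → X → ℝ) : Prop :=
  (∀ x, d x x = 0) ∧ (∀ x y, d x y = d y x) ∧ (∀ x y, 0 ≤ d x y) ∧
    (∀ x y z, d x z ≤ d x y + d y z)

/-- The CAT(0) four-point condition for a distance function `d` on `X`: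
every 4-tuple admits a comparison configuration in the Euclidean plane. -/
def FourPointCAT0 {X : Type*} (d : X → X → ℝ) : Prop :=
  ∀ x₁ y₁ x₂ y₂ : X, ∃ a₁ b₁ a₂ b₂ : EuclideanSpace ℝ (Fin 2),
    dist a₁ b₁ = d x₁ y₁ ∧ dist a₁ b₂ = d x₁ y₂ ∧
    dist a₂ b₁ = d x₂ y₁ ∧ dist a₂ b₂ = d x₂ y₂ ∧
    d x₁ x₂ ≤ dist a₁ a₂ ∧ d y₁ y₂ ≤ dist b₁ b₂

/-- The CAT(0) four-point condition is stable under pointwise limits of pseudometrics. -/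
theorem stmt12 {X : Type*} (dk : ℕ → X → X → ℝ) (d : X → X → ℝ)
    (hpseudo : ∀ k, IsPseudometric (dk k))
    (hlim : ∀ x y, Tendsto (fun k => dk k x y) atTop (nhds (d x y)))
    (hfour : ∀ k, FourPointCAT0 (dk k)) :
    FourPointCAT0 d := by
  intro x₁ y₁ x₂ y₂
  choose a₁ b₁ a₂ b₂ h11 h12 h21 h22 ha hb using fun k => hfour k x₁ y₁ x₂ y₂
  obtain ⟨R₁, hR₁⟩ := (hlim x₁ y₁).bddAbove_range
  obtain ⟨R₂, hR₂⟩ := (hlim x₁ y₂).bddAbove_range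
  obtain ⟨R₃, hR₃⟩ := (hlim x₂ y₁).bddAbove_range
  have e1 : ∀ k, dk k x₁ y₁ ≤ R₁ := fun k => hR₁ ⟨k, rfl⟩
  have e2 : ∀ k, dk k x₁ y₂ ≤ R₂ := fun k => hR₂ ⟨k, rfl⟩
  have e3 : ∀ k, dk k x₂ y₁ ≤ R₃ := fun k => hR₃ ⟨k, rfl⟩
  let E := EuclideanSpace ℝ (Fin 2)
  let K : Set (E × E × E) := Metric.closedBall 0 R₁ ×ˢ
    (Metric.closedBall 0 (R₁ + R₃) ×ˢ Metric.closedBall 0 R₂)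
  have hK : IsCompact K := (isCompact_closedBall _ _).prod
    ((isCompact_closedBall _ _).prod (isCompact_closedBall _ _))
  let u : ℕ → E × E × E := fun k => (b₁ k - a₁ k, a₂ k - a₁ k, b₂ k - a₁ k)
  have hu : ∀ k, u k ∈ K := by
    intro k
    refine ⟨?_, ?_, ?_⟩
    · simp only [u, mem_closedBall_zero_iff, ← dist_eq_norm]
      rw [dist_comm, h11]; exact e1 k
    · simp only [u, mem_closedBall_zero_iff, ← dist_eq_norm]
      have := dist_triangle (a₂ k) (b₁ k) (a₁ k)
      rw [h21, dist_comm (b₁ k), h11] at this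
      linarith [e1 k, e3 k]
    · simp only [u, mem_closedBall_zero_iff, ← dist_eq_norm]
      rw [dist_comm, h12]; exact e2 k
  obtain ⟨⟨p, q, r⟩, -, φ, hφ, hconv⟩ := hK.tendsto_subseq hu
  have hp : Tendsto (fun k => b₁ (φ k) - a₁ (φ k)) atTop (nhds p) :=
    (continuous_fst.tendsto _).comp hconv
  have hq : Tendsto (fun k => a₂ (φ k) - a₁ (φ k)) atTop (nhds q) :=
    ((continuous_fst.comp continuous_snd).tendsto _).comp hconv
  have hr : Tendsto (fun k => b₂ (φ k) - a₁ (φ k)) atTop (nhds r) :=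
    ((continuous_snd.comp continuous_snd).tendsto _).comp hconv
  have h0 : Tendsto (fun k => a₁ (φ k) - a₁ (φ k)) atTop (nhds (0 : E)) := by
    simp only [sub_self]; exact tendsto_const_nhds
  have L : ∀ x y, Tendsto (fun k => dk (φ k) x y) atTop (nhds (d x y)) :=
    fun x y => (hlim x y).comp hφ.tendsto_atTop
  refine ⟨0, p, q, r, ?_, ?_, ?_, ?_, ?_, ?_⟩
  · refine tendsto_nhds_unique ((h0.dist hp).congr fun k => ?_) (L _ _)
    rw [dist_sub_right, h11]
  · refine tendsto_nhds_unique ((h0.dist hr).congr fun k => ?_) (L _ _)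
    rw [dist_sub_right, h12]
  · refine tendsto_nhds_unique ((hq.dist hp).congr fun k => ?_) (L _ _)
    rw [dist_sub_right, h21]
  · refine tendsto_nhds_unique ((hq.dist hr).congr fun k => ?_) (L _ _)
    rw [dist_sub_right, h22]
  · refine le_of_tendsto_of_tendsto' (L _ _) (h0.dist hq) fun k => ?_
    rw [dist_sub_right]; exact ha _
  · refine le_of_tendsto_of_tendsto' (L _ _) (hp.dist hr) fun k => ?_
    rw [dist_sub_right]; exact hb _
end
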